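/- arXiv:2307.14826 — 8 statements merged into one kernel-verified Lean document; each statement's English description precedes it below -/
import Mathlib

section
/- Let ζ be an Eilenberg–Moore law of a monad T over an endofunctor F on a category C, and let (Ω, o) be a T-algebra. Suppose a morphism λ : F(T(Ω)) → Ω satisfies the coequalization condition λ ∘ F(μ_Ω) = λ ∘ F(T(o)) and the homomorphy condition λ ∘ F(μ_Ω) ∘ ζ_{T(Ω)} = o ∘ T(λ). Then there exists a unique morphism ev : F(Ω) → Ω such that λ = ev ∘ F(o), and this ev is a T-algebra homomorphism from the lifting F̃(Ω, o) to (Ω, o), i.e. ev ∘ (F(o) ∘ ζ_Ω) = o ∘ T(ev). -/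
open CategoryTheory

universe v u

/-- every graded-logic modality (coequalization + homomorphy) factors
uniquely through `F o`, and the factor is a T-algebra homomorphism from the lifting
`F̃(Ω, o)` to `(Ω, o)`. -/
theorem modality_factors_uniquely_through_lifting
    {C : Type u} [Category.{v} C]
    (T : C ⥤ C) (F : C ⥤ C)
    (η : ∀ X : C, X ⟶ T.obj X) (μ : ∀ X : C, T.obj (T.obj X) ⟶ T.obj X)
    (hη_nat : ∀ {X Y : C} (f : X ⟶ Y), f ≫ η Y = η X ≫ T.map f)
    (hμ_nat : ∀ {X Y : C} (f : X ⟶ Y), T.map (T.map f) ≫ μ Y = μ X ≫ T.map f)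
    (h_unit_l : ∀ X : C, η (T.obj X) ≫ μ X = 𝟙 (T.obj X))
    (h_unit_r : ∀ X : C, T.map (η X) ≫ μ X = 𝟙 (T.obj X))
    (h_assoc : ∀ X : C, T.map (μ X) ≫ μ X = μ (T.obj X) ≫ μ X)
    (ζ : ∀ X : C, T.obj (F.obj X) ⟶ F.obj (T.obj X))
    (hζ_nat : ∀ {X Y : C} (f : X ⟶ Y), T.map (F.map f) ≫ ζ Y = ζ X ≫ F.map (T.map f))
    (hζ_η : ∀ X : C, η (F.obj X) ≫ ζ X = F.map (η X))
    (hζ_μ : ∀ X : C, μ (F.obj X) ≫ ζ X = T.map (ζ X) ≫ ζ (T.obj X) ≫ F.map (μ X))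
    (Ω : C) (o : T.obj Ω ⟶ Ω)
    (ho_unit : η Ω ≫ o = 𝟙 Ω) (ho_mul : μ Ω ≫ o = T.map o ≫ o)
    (lam : F.obj (T.obj Ω) ⟶ Ω)
    (hcoeq : F.map (μ Ω) ≫ lam = F.map (T.map o) ≫ lam)
    (hhom : ζ (T.obj Ω) ≫ F.map (μ Ω) ≫ lam = T.map lam ≫ o) :
    (∃! ev : F.obj Ω ⟶ Ω, F.map o ≫ ev = lam) ∧
    (∀ ev : F.obj Ω ⟶ Ω, F.map o ≫ ev = lam →
      (ζ Ω ≫ F.map o) ≫ ev = T.map ev ≫ o) := by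
  have eq_of_factor (ev : F.obj Ω ⟶ Ω) (hev : F.map o ≫ ev = lam) :
      ev = F.map (η Ω) ≫ lam := by
    rw [← hev, ← Category.assoc, ← F.map_comp, ho_unit, F.map_id, Category.id_comp]
  refine ⟨⟨F.map (η Ω) ≫ lam, ?_, eq_of_factor⟩, fun ev hev => ?_⟩
  · change F.map o ≫ F.map (η Ω) ≫ lam = lam
    rw [← Category.assoc, ← F.map_comp, hη_nat, F.map_comp, Category.assoc, ← hcoeq,
      ← Category.assoc, ← F.map_comp, h_unit_l, F.map_id, Category.id_comp]
  · calc (ζ Ω ≫ F.map o) ≫ ev = ζ Ω ≫ lam := by rw [Category.assoc, hev]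
      _ = ζ Ω ≫ F.map (T.map (η Ω)) ≫ F.map (μ Ω) ≫ lam := by
        rw [← Category.assoc (F.map _) (F.map _), ← F.map_comp, h_unit_r, F.map_id,
          Category.id_comp]
      _ = T.map (F.map (η Ω)) ≫ ζ (T.obj Ω) ≫ F.map (μ Ω) ≫ lam := by
        rw [← Category.assoc (ζ Ω), ← hζ_nat, Category.assoc]
      _ = T.map ev ≫ o := by
        rw [hhom, eq_of_factor ev hev, T.map_comp, Category.assoc]
end

section
/- Let ζ be an Eilenberg–Moore law of a monad T over an endofunctor F on a category C, and let (Ω, o) be a T-algebra. If ev : F(Ω) → Ω is a T-algebra homomorphism from the lifting F̃(Ω, o) to (Ω, o), i.e. ev ∘ (F(o) ∘ ζ_Ω) = o ∘ T(ev), then the morphism λ := ev ∘ F(o) : F(T(Ω)) → Ω satisfies both the coequalization condition λ ∘ F(μ_Ω) = λ ∘ F(T(o)) and the homomorphy condition λ ∘ F(μ_Ω) ∘ ζ_{T(Ω)} = o ∘ T(λ). -/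
open CategoryTheory

universe v u

/-- every T-algebra homomorphism `ev : F̃(Ω,o) → (Ω,o)` yields a
modality `λ = ev ∘ F o` satisfying coequalization and homomorphy. -/
theorem algebra_hom_yields_modality
    {C : Type u} [Category.{v} C]
    (T : C ⥤ C) (F : C ⥤ C)
    (η : ∀ X : C, X ⟶ T.obj X) (μ : ∀ X : C, T.obj (T.obj X) ⟶ T.obj X)
    (hη_nat : ∀ {X Y : C} (f : X ⟶ Y), f ≫ η Y = η X ≫ T.map f)
    (hμ_nat : ∀ {X Y : C} (f : X ⟶ Y), T.map (T.map f) ≫ μ Y = μ X ≫ T.map f)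
    (h_unit_l : ∀ X : C, η (T.obj X) ≫ μ X = 𝟙 (T.obj X))
    (h_unit_r : ∀ X : C, T.map (η X) ≫ μ X = 𝟙 (T.obj X))
    (h_assoc : ∀ X : C, T.map (μ X) ≫ μ X = μ (T.obj X) ≫ μ X)
    (ζ : ∀ X : C, T.obj (F.obj X) ⟶ F.obj (T.obj X))
    (hζ_nat : ∀ {X Y : C} (f : X ⟶ Y), T.map (F.map f) ≫ ζ Y = ζ X ≫ F.map (T.map f))
    (hζ_η : ∀ X : C, η (F.obj X) ≫ ζ X = F.map (η X))
    (hζ_μ : ∀ X : C, μ (F.obj X) ≫ ζ X = T.map (ζ X) ≫ ζ (T.obj X) ≫ F.map (μ X))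
    (Ω : C) (o : T.obj Ω ⟶ Ω)
    (ho_unit : η Ω ≫ o = 𝟙 Ω) (ho_mul : μ Ω ≫ o = T.map o ≫ o)
    (ev : F.obj Ω ⟶ Ω)
    (hev : (ζ Ω ≫ F.map o) ≫ ev = T.map ev ≫ o) :
    (F.map (μ Ω) ≫ (F.map o ≫ ev) = F.map (T.map o) ≫ (F.map o ≫ ev)) ∧
    (ζ (T.obj Ω) ≫ F.map (μ Ω) ≫ (F.map o ≫ ev) = T.map (F.map o ≫ ev) ≫ o) := by
  have coequalization :
      F.map (μ Ω) ≫ (F.map o ≫ ev) = F.map (T.map o) ≫ (F.map o ≫ ev) := by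
    rw [← F.map_comp_assoc, ho_mul, F.map_comp_assoc]
  refine ⟨coequalization, ?_⟩
  rw [coequalization, ← Category.assoc, ← hζ_nat, T.map_comp, Category.assoc, Category.assoc,
    ← hev, Category.assoc]
end

section
/- Let ζ be an Eilenberg–Moore law of a monad T over an endofunctor F on a category C, and let c : X → F(T(X)) be a morphism (an FT-coalgebra). Define the determinization c^# := F(μ_X) ∘ ζ_{T(X)} ∘ T(c) : T(X) → F(T(X)). Then: (i) c^# ∘ η_X = c; (ii) c^# ∘ μ_X = (F(μ_X) ∘ ζ_{T(X)}) ∘ T(c^#), i.e. c^# is a T-algebra homomorphism from the free algebra (T(X), μ_X) to the lifted algebra (F(T(X)), F(μ_X) ∘ ζ_{T(X)}); and (iii) c^# is the unique morphism h : T(X) → F(T(X)) satisfying both h ∘ η_X = c and h ∘ μ_X = (F(μ_X) ∘ ζ_{T(X)}) ∘ T(h). -/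
open CategoryTheory

universe v u

/-- the determinization `c^# = F μ_X ∘ ζ_{T X} ∘ T c` of an
FT-coalgebra extends `c` along `η`, is a T-algebra homomorphism from the free
algebra to the lifted algebra, and is unique with these two properties. -/
theorem determinization_characterization
    {C : Type u} [Category.{v} C]
    (T : C ⥤ C) (F : C ⥤ C)
    (η : ∀ X : C, X ⟶ T.obj X) (μ : ∀ X : C, T.obj (T.obj X) ⟶ T.obj X)
    (hη_nat : ∀ {X Y : C} (f : X ⟶ Y), f ≫ η Y = η X ≫ T.map f)
    (hμ_nat : ∀ {X Y : C} (f : X ⟶ Y), T.map (T.map f) ≫ μ Y = μ X ≫ T.map f)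
    (h_unit_l : ∀ X : C, η (T.obj X) ≫ μ X = 𝟙 (T.obj X))
    (h_unit_r : ∀ X : C, T.map (η X) ≫ μ X = 𝟙 (T.obj X))
    (h_assoc : ∀ X : C, T.map (μ X) ≫ μ X = μ (T.obj X) ≫ μ X)
    (ζ : ∀ X : C, T.obj (F.obj X) ⟶ F.obj (T.obj X))
    (hζ_nat : ∀ {X Y : C} (f : X ⟶ Y), T.map (F.map f) ≫ ζ Y = ζ X ≫ F.map (T.map f))
    (hζ_η : ∀ X : C, η (F.obj X) ≫ ζ X = F.map (η X))
    (hζ_μ : ∀ X : C, μ (F.obj X) ≫ ζ X = T.map (ζ X) ≫ ζ (T.obj X) ≫ F.map (μ X))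
    (X : C) (c : X ⟶ F.obj (T.obj X)) :
    (η X ≫ (T.map c ≫ ζ (T.obj X) ≫ F.map (μ X)) = c) ∧
    (μ X ≫ (T.map c ≫ ζ (T.obj X) ≫ F.map (μ X)) =
      T.map (T.map c ≫ ζ (T.obj X) ≫ F.map (μ X)) ≫ ζ (T.obj X) ≫ F.map (μ X)) ∧
    (∀ h : T.obj X ⟶ F.obj (T.obj X),
      η X ≫ h = c →
      μ X ≫ h = T.map h ≫ ζ (T.obj X) ≫ F.map (μ X) →
      h = T.map c ≫ ζ (T.obj X) ≫ F.map (μ X)) := by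
  refine ⟨?_, ?_, ?_⟩
  · rw [← Category.assoc, ← hη_nat, Category.assoc, ← Category.assoc (η _), hζ_η,
      ← F.map_comp, h_unit_l, F.map_id, Category.comp_id]
  · calc
      _ = T.map (T.map c) ≫ (μ (F.obj (T.obj X)) ≫ ζ (T.obj X)) ≫ F.map (μ X) := by
        rw [← Category.assoc, ← hμ_nat]
        simp only [Category.assoc]
      _ = T.map (T.map c) ≫ T.map (ζ (T.obj X)) ≫ ζ (T.obj (T.obj X)) ≫
          F.map (T.map (μ X)) ≫ F.map (μ X) := by
        rw [hζ_μ, ← F.map_comp (T.map (μ X)), h_assoc]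
        simp only [Category.assoc, F.map_comp]
      _ = _ := by
        rw [← Category.assoc (ζ (T.obj (T.obj X))), ← hζ_nat]
        simp only [Category.assoc, T.map_comp]
  · rintro h rfl h_hom
    rw [T.map_comp, Category.assoc, ← h_hom, ← Category.assoc, h_unit_r, Category.id_comp]
end

section
/- Let ζ be an Eilenberg–Moore law of a monad T over an endofunctor F on a category C. Define, for natural numbers p, q and object X, the graded multiplication μ^{p,q}_X := F^{p+q}(μ_X) ∘ F^p(ζ^{(q)}_{T(X)}) : F^p(T(F^q(T(X)))) → F^{p+q}(T(X)), where ζ^{(q)} is the iterated law (ζ^{(0)} = id, ζ^{(q+1)}_X = F(ζ^{(q)}_X) ∘ ζ_{F^q(X)}). Then the graded associativity law holds: for all n, k, m and every object X, μ^{n,k+m}_X ∘ F^n(T(μ^{k,m}_X)) = μ^{n+k,m}_X ∘ μ^{n,k}_{F^m(T(X))}. -/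
open CategoryTheory

universe v u

variable {C : Type u} [Category.{v} C]

/-- The n-fold composite of an endofunctor, with `F^(n+1) = F ∘ F^n`. -/
def Fpow (F : C ⥤ C) : ℕ → C ⥤ C
  | 0 => 𝟭 C
  | n + 1 => Fpow F n ⋙ F

theorem Fpow_comm_obj (F : C ⥤ C) : ∀ (m : ℕ) (Y : C),
    F.obj ((Fpow F m).obj Y) = (Fpow F m).obj (F.obj Y)
  | 0, _ => rfl
  | m + 1, Y => congrArg F.obj (Fpow_comm_obj F m Y)

theorem Fpow_add_obj (F : C ⥤ C) (m : ℕ) : ∀ (n : ℕ) (X : C),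
    (Fpow F (m + n)).obj X = (Fpow F m).obj ((Fpow F n).obj X)
  | 0, _ => rfl
  | n + 1, X => (congrArg F.obj (Fpow_add_obj F m n X)).trans
      (Fpow_comm_obj F m ((Fpow F n).obj X))

/-- The iterated Eilenberg–Moore law `ζ^(n) : T F^n ⟶ F^n T`. -/
def zetaIter (T F : C ⥤ C) (ζ : ∀ X : C, T.obj (F.obj X) ⟶ F.obj (T.obj X)) :
    ∀ (n : ℕ) (X : C), T.obj ((Fpow F n).obj X) ⟶ (Fpow F n).obj (T.obj X)
  | 0, X => 𝟙 (T.obj X)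
  | n + 1, X => ζ ((Fpow F n).obj X) ≫ F.map (zetaIter T F ζ n X)

/-- The graded multiplication `μ^(p,q)_X = F^(p+q) μ_X ∘ F^p (ζ^(q)_{T X})` of the
graded monad `M_ζ` with `M_n = F^n T`. -/
def gradedMu (T F : C ⥤ C) (μ : ∀ X : C, T.obj (T.obj X) ⟶ T.obj X)
    (ζ : ∀ X : C, T.obj (F.obj X) ⟶ F.obj (T.obj X)) (p q : ℕ) (X : C) :
    (Fpow F p).obj (T.obj ((Fpow F q).obj (T.obj X))) ⟶ (Fpow F (p + q)).obj (T.obj X) :=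
  (Fpow F p).map (zetaIter T F ζ q (T.obj X)) ≫
    eqToHom (Fpow_add_obj F p q (T.obj (T.obj X))).symm ≫
    (Fpow F (p + q)).map (μ X)

theorem Fpow_comm_map (F : C ⥤ C) : ∀ (m : ℕ) {X Y : C} (f : X ⟶ Y),
    F.map ((Fpow F m).map f) ≫ eqToHom (Fpow_comm_obj F m Y) =
      eqToHom (Fpow_comm_obj F m X) ≫ (Fpow F m).map (F.map f)
  | 0, _, _, _ => (Category.comp_id _).trans (Category.id_comp _).symm
  | m + 1, X, Y, f => by
    have h := congrArg F.map (Fpow_comm_map F m f)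
    simp only [Functor.map_comp, eqToHom_map] at h
    exact h

theorem Fpow_add_map (F : C ⥤ C) (m : ℕ) : ∀ (n : ℕ) {X Y : C} (f : X ⟶ Y),
    (Fpow F (m + n)).map f ≫ eqToHom (Fpow_add_obj F m n Y) =
      eqToHom (Fpow_add_obj F m n X) ≫ (Fpow F m).map ((Fpow F n).map f)
  | 0, _, _, _ => (Category.comp_id _).trans (Category.id_comp _).symm
  | n + 1, X, Y, f => by
    have h := congrArg F.map (Fpow_add_map F m n f)
    simp only [Functor.map_comp, eqToHom_map] at h
    have hc := Fpow_comm_map F m ((Fpow F n).map f)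
    change F.map ((Fpow F (m + n)).map f) ≫ eqToHom _ =
      eqToHom _ ≫ (Fpow F m).map (F.map ((Fpow F n).map f))
    rw [← eqToHom_trans (congrArg F.obj (Fpow_add_obj F m n Y)) (Fpow_comm_obj F m _),
      reassoc_of% h, hc, eqToHom_trans_assoc]

theorem Fpow_add_map_symm (F : C ⥤ C) (m n : ℕ) {X Y : C} (f : X ⟶ Y) :
    eqToHom (Fpow_add_obj F m n X).symm ≫ (Fpow F (m + n)).map f =
      (Fpow F m).map ((Fpow F n).map f) ≫ eqToHom (Fpow_add_obj F m n Y).symm := by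
  rw [eqToHom_comp_iff, ← Category.assoc, ← comp_eqToHom_iff (Fpow_add_obj F m n Y),
    Fpow_add_map]

theorem Fpow_map_eqToHom (F : C ⥤ C) {i j : ℕ} (h : i = j) {X Y : C} (f : X ⟶ Y) :
    (Fpow F i).map f ≫ eqToHom (congrArg (fun l : ℕ => (Fpow F l).obj Y) h) =
      eqToHom (congrArg (fun l : ℕ => (Fpow F l).obj X) h) ≫ (Fpow F j).map f := by
  subst h
  simp

/-- Components of a family of morphisms at equal objects agree up to transport. -/
theorem family_eqToHom {D : Type*} {G H : D → C} (α : ∀ X, G X ⟶ H X) {X Y : D} (h : X = Y) :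
    α X ≫ eqToHom (congrArg H h) = eqToHom (congrArg G h) ≫ α Y := by
  subst h
  simp

section ZetaIter

variable (T F : C ⥤ C) (ζ : ∀ X : C, T.obj (F.obj X) ⟶ F.obj (T.obj X))

theorem zetaIter_naturality
    (hζ_nat : ∀ {X Y : C} (f : X ⟶ Y), T.map (F.map f) ≫ ζ Y = ζ X ≫ F.map (T.map f)) :
    ∀ (n : ℕ) {X Y : C} (f : X ⟶ Y),
      T.map ((Fpow F n).map f) ≫ zetaIter T F ζ n Y =
        zetaIter T F ζ n X ≫ (Fpow F n).map (T.map f)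
  | 0, _, _, f => by simp [Fpow, zetaIter]
  | n + 1, X, Y, f => by
    change T.map (F.map ((Fpow F n).map f)) ≫ ζ _ ≫ F.map (zetaIter T F ζ n Y) =
      (ζ _ ≫ F.map (zetaIter T F ζ n X)) ≫ F.map ((Fpow F n).map (T.map f))
    rw [reassoc_of% hζ_nat, ← F.map_comp, zetaIter_naturality hζ_nat n f, F.map_comp,
      Category.assoc]

theorem mu_comp_zetaIter (μ : ∀ X : C, T.obj (T.obj X) ⟶ T.obj X)
    (hζ_nat : ∀ {X Y : C} (f : X ⟶ Y), T.map (F.map f) ≫ ζ Y = ζ X ≫ F.map (T.map f))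
    (hζ_μ : ∀ X : C, μ (F.obj X) ≫ ζ X = T.map (ζ X) ≫ ζ (T.obj X) ≫ F.map (μ X)) :
    ∀ (n : ℕ) (X : C),
      μ ((Fpow F n).obj X) ≫ zetaIter T F ζ n X =
        T.map (zetaIter T F ζ n X) ≫ zetaIter T F ζ n (T.obj X) ≫ (Fpow F n).map (μ X)
  | 0, X => by simp [Fpow, zetaIter]
  | n + 1, X => by
    change μ (F.obj ((Fpow F n).obj X)) ≫ ζ _ ≫ F.map (zetaIter T F ζ n X) =
      T.map (ζ _ ≫ F.map (zetaIter T F ζ n X)) ≫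
        (ζ _ ≫ F.map (zetaIter T F ζ n (T.obj X))) ≫ F.map ((Fpow F n).map (μ X))
    rw [reassoc_of% hζ_μ, ← F.map_comp, mu_comp_zetaIter μ hζ_nat hζ_μ n X]
    simp only [Functor.map_comp, Category.assoc]
    rw [reassoc_of% hζ_nat]

theorem zetaIter_comm : ∀ (k : ℕ) (Y : C),
    T.map (eqToHom (Fpow_comm_obj F k Y)) ≫ zetaIter T F ζ k (F.obj Y) ≫ (Fpow F k).map (ζ Y) =
      ζ ((Fpow F k).obj Y) ≫ F.map (zetaIter T F ζ k Y) ≫ eqToHom (Fpow_comm_obj F k (T.obj Y))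
  | 0, Y => by
    change T.map (𝟙 (F.obj Y)) ≫ 𝟙 _ ≫ ζ Y = ζ Y ≫ F.map (𝟙 (T.obj Y)) ≫ 𝟙 _
    simp
  | k + 1, Y => by
    have ih := congrArg F.map (zetaIter_comm k Y)
    simp only [Functor.map_comp, eqToHom_map] at ih
    have hζ := family_eqToHom ζ (Fpow_comm_obj F k Y)
    change T.map (eqToHom (congrArg F.obj (Fpow_comm_obj F k Y))) ≫
      (ζ _ ≫ F.map (zetaIter T F ζ k (F.obj Y))) ≫ F.map ((Fpow F k).map (ζ Y)) =
      ζ _ ≫ F.map (ζ _ ≫ F.map (zetaIter T F ζ k Y)) ≫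
        eqToHom (congrArg F.obj (Fpow_comm_obj F k (T.obj Y)))
    simp only [eqToHom_map, Functor.map_comp, Category.assoc]
    rw [← ih, reassoc_of% hζ]

theorem zetaIter_add (k : ℕ) : ∀ (m : ℕ) (X : C),
    T.map (eqToHom (Fpow_add_obj F k m X)) ≫
      zetaIter T F ζ k ((Fpow F m).obj X) ≫ (Fpow F k).map (zetaIter T F ζ m X) =
      zetaIter T F ζ (k + m) X ≫ eqToHom (Fpow_add_obj F k m (T.obj X))
  | 0, X => by
    change T.map (𝟙 _) ≫ zetaIter T F ζ k X ≫ (Fpow F k).map (𝟙 (T.obj X)) =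
      zetaIter T F ζ k X ≫ 𝟙 _
    simp
  | m + 1, X => by
    have ih := congrArg F.map (zetaIter_add k m X)
    simp only [Functor.map_comp, eqToHom_map] at ih
    have hζ := family_eqToHom ζ (Fpow_add_obj F k m X)
    have hc := zetaIter_comm T F ζ k ((Fpow F m).obj X)
    have hF := Fpow_comm_map F k (zetaIter T F ζ m X)
    rw [eqToHom_map] at hc
    change T.map (eqToHom _) ≫ zetaIter T F ζ k (F.obj ((Fpow F m).obj X)) ≫
      (Fpow F k).map (ζ _ ≫ F.map (zetaIter T F ζ m X)) =
      (ζ _ ≫ F.map (zetaIter T F ζ (k + m) X)) ≫ eqToHom _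
    rw [← eqToHom_trans (congrArg F.obj (Fpow_add_obj F k m _)) (Fpow_comm_obj F k _),
      ← eqToHom_trans (congrArg F.obj (Fpow_add_obj F k m _)) (Fpow_comm_obj F k _)]
    simp only [eqToHom_map, Functor.map_comp, Category.assoc]
    rw [reassoc_of% hc, ← hF, ← reassoc_of% ih, reassoc_of% hζ]

end ZetaIter

/-- the graded associativity law
`μ^(n,k+m)_X ∘ F^n T (μ^(k,m)_X) = μ^(n+k,m)_X ∘ μ^(n,k)_{F^m T X}`. -/
theorem gradedMu_assoc
    (T : C ⥤ C) (F : C ⥤ C)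
    (η : ∀ X : C, X ⟶ T.obj X) (μ : ∀ X : C, T.obj (T.obj X) ⟶ T.obj X)
    (hη_nat : ∀ {X Y : C} (f : X ⟶ Y), f ≫ η Y = η X ≫ T.map f)
    (hμ_nat : ∀ {X Y : C} (f : X ⟶ Y), T.map (T.map f) ≫ μ Y = μ X ≫ T.map f)
    (h_unit_l : ∀ X : C, η (T.obj X) ≫ μ X = 𝟙 (T.obj X))
    (h_unit_r : ∀ X : C, T.map (η X) ≫ μ X = 𝟙 (T.obj X))
    (h_assoc : ∀ X : C, T.map (μ X) ≫ μ X = μ (T.obj X) ≫ μ X)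
    (ζ : ∀ X : C, T.obj (F.obj X) ⟶ F.obj (T.obj X))
    (hζ_nat : ∀ {X Y : C} (f : X ⟶ Y), T.map (F.map f) ≫ ζ Y = ζ X ≫ F.map (T.map f))
    (hζ_η : ∀ X : C, η (F.obj X) ≫ ζ X = F.map (η X))
    (hζ_μ : ∀ X : C, μ (F.obj X) ≫ ζ X = T.map (ζ X) ≫ ζ (T.obj X) ≫ F.map (μ X))
    (n k m : ℕ) (X : C) :
    (Fpow F n).map (T.map (gradedMu T F μ ζ k m X)) ≫ gradedMu T F μ ζ n (k + m) X =
      gradedMu T F μ ζ n k ((Fpow F m).obj (T.obj X)) ≫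
        gradedMu T F μ ζ (n + k) m X ≫
        eqToHom (congrArg (fun j : ℕ => (Fpow F j).obj (T.obj X)) (Nat.add_assoc n k m)) := by
  have hnat := zetaIter_naturality T F ζ hζ_nat
  have hmu := mu_comp_zetaIter T F ζ μ hζ_nat hζ_μ m (T.obj X)
  have hadd : T.map (eqToHom (Fpow_add_obj F k m (T.obj (T.obj X))).symm) ≫
      zetaIter T F ζ (k + m) (T.obj (T.obj X)) =
      zetaIter T F ζ k _ ≫ (Fpow F k).map (zetaIter T F ζ m _) ≫
        eqToHom (Fpow_add_obj F k m (T.obj (T.obj (T.obj X)))).symm := by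
    rw [eqToHom_map, eqToHom_comp_iff, ← Category.assoc, ← Category.assoc,
      ← comp_eqToHom_iff (Fpow_add_obj F k m _), ← zetaIter_add, eqToHom_map, Category.assoc]
  have hinner : T.map (gradedMu T F μ ζ k m X) ≫ zetaIter T F ζ (k + m) (T.obj X) =
      zetaIter T F ζ k _ ≫
        (Fpow F k).map (T.map (zetaIter T F ζ m _) ≫ zetaIter T F ζ m _) ≫
        eqToHom (Fpow_add_obj F k m _).symm ≫ (Fpow F (k + m)).map (T.map (μ X)) := by
    simp only [gradedMu, Functor.map_comp, Category.assoc]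
    rw [hnat, reassoc_of% hadd, reassoc_of% hnat]
  have hleft : (Fpow F n).map (T.map (gradedMu T F μ ζ k m X)) ≫ gradedMu T F μ ζ n (k + m) X =
      (Fpow F n).map (zetaIter T F ζ k _ ≫
        (Fpow F k).map (T.map (zetaIter T F ζ m _) ≫ zetaIter T F ζ m _) ≫
        eqToHom (Fpow_add_obj F k m _).symm) ≫ eqToHom (Fpow_add_obj F n (k + m) _).symm ≫
        (Fpow F (n + (k + m))).map (T.map (μ X) ≫ μ X) := by
    rw [gradedMu.eq_def T F μ ζ n, ← Functor.map_comp_assoc, hinner]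
    simp only [Functor.map_comp, Category.assoc]
    rw [← reassoc_of% Fpow_add_map_symm]
  rw [hleft, h_assoc]
  simp only [gradedMu, Category.assoc]
  rw [← Functor.map_comp_assoc (Fpow F (n + k)), hmu,
    Fpow_map_eqToHom F (Nat.add_assoc n k m) (μ X)]
  rw [← Category.assoc (T.map _), Functor.map_comp (Fpow F (n + k)), Category.assoc,
    ← reassoc_of% Fpow_add_map_symm F (n + k) m (μ (T.obj X)),
    reassoc_of% Fpow_map_eqToHom F (Nat.add_assoc n k m) (μ (T.obj X)),
    reassoc_of% Fpow_add_map_symm F n k]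
  simp only [Functor.map_comp, Category.assoc, eqToHom_map, eqToHom_trans_assoc]
end

section
/- Let ζ be an Eilenberg–Moore law of a monad T over an endofunctor F on a category C. For every object X and natural number n, the morphism μ^{0,n}_X := F^n(μ_X) ∘ ζ^{(n)}_{T(X)} : T(F^n(T(X))) → F^n(T(X)) is a T-algebra structure on F^n(T(X)), and consequently F(μ^{0,n}_X) : F(T(F^n(T(X)))) → F^{n+1}(T(X)) is a split coequalizer of the parallel pair F(μ_{F^n(T(X))}) and F(T(μ^{0,n}_X)); i.e. the graded multiplication μ^{1,n}_X = F(μ^{0,n}_X) coequalizes μ^{1,0} at F^n(T(X)) and F(T(μ^{0,n}_X)) (the graded monad M_ζ is depth-1). -/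
open CategoryTheory

universe v u

variable {C : Type u} [Category.{v} C]

/-- The graded multiplication `μ^(0,n)_X = F^n μ_X ∘ ζ^(n)_{T X} : T F^n T X ⟶ F^n T X`. -/
def muZeroN (T F : C ⥤ C) (μ : ∀ X : C, T.obj (T.obj X) ⟶ T.obj X)
    (ζ : ∀ X : C, T.obj (F.obj X) ⟶ F.obj (T.obj X)) (n : ℕ) (X : C) :
    T.obj ((Fpow F n).obj (T.obj X)) ⟶ (Fpow F n).obj (T.obj X) :=
  zetaIter T F ζ n (T.obj X) ≫ (Fpow F n).map (μ X)

/-- The lifting of `F` along an Eilenberg–Moore law preserves the unit law of algebras. -/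
theorem lift_algebra_unit {T F : C ⥤ C} {η : ∀ X : C, X ⟶ T.obj X}
    {ζ : ∀ X : C, T.obj (F.obj X) ⟶ F.obj (T.obj X)}
    (hζ_η : ∀ X : C, η (F.obj X) ≫ ζ X = F.map (η X))
    {A : C} {a : T.obj A ⟶ A} (ha : η A ≫ a = 𝟙 A) :
    η (F.obj A) ≫ ζ A ≫ F.map a = 𝟙 (F.obj A) := by
  rw [← Category.assoc, hζ_η, ← F.map_comp, ha, F.map_id]

/-- The lifting of `F` along an Eilenberg–Moore law preserves the associativity law of algebras. -/
theorem lift_algebra_assoc {T F : C ⥤ C} {μ : ∀ X : C, T.obj (T.obj X) ⟶ T.obj X}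
    {ζ : ∀ X : C, T.obj (F.obj X) ⟶ F.obj (T.obj X)}
    (hζ_nat : ∀ {X Y : C} (f : X ⟶ Y), T.map (F.map f) ≫ ζ Y = ζ X ≫ F.map (T.map f))
    (hζ_μ : ∀ X : C, μ (F.obj X) ≫ ζ X = T.map (ζ X) ≫ ζ (T.obj X) ≫ F.map (μ X))
    {A : C} {a : T.obj A ⟶ A} (ha : μ A ≫ a = T.map a ≫ a) :
    μ (F.obj A) ≫ ζ A ≫ F.map a = T.map (ζ A ≫ F.map a) ≫ ζ A ≫ F.map a := by
  calc μ (F.obj A) ≫ ζ A ≫ F.map a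
      = T.map (ζ A) ≫ ζ (T.obj A) ≫ F.map (μ A ≫ a) := by
        rw [← Category.assoc, hζ_μ]; simp
    _ = T.map (ζ A) ≫ (ζ (T.obj A) ≫ F.map (T.map a)) ≫ F.map a := by
        rw [ha]; simp
    _ = T.map (ζ A ≫ F.map a) ≫ ζ A ≫ F.map a := by
        rw [← hζ_nat]; simp

theorem muZeroN_zero (T F : C ⥤ C) (μ : ∀ X : C, T.obj (T.obj X) ⟶ T.obj X)
    (ζ : ∀ X : C, T.obj (F.obj X) ⟶ F.obj (T.obj X)) (X : C) :
    muZeroN T F μ ζ 0 X = μ X :=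
  Category.id_comp _

theorem muZeroN_succ (T F : C ⥤ C) (μ : ∀ X : C, T.obj (T.obj X) ⟶ T.obj X)
    (ζ : ∀ X : C, T.obj (F.obj X) ⟶ F.obj (T.obj X)) (n : ℕ) (X : C) :
    muZeroN T F μ ζ (n + 1) X =
      ζ ((Fpow F n).obj (T.obj X)) ≫ F.map (muZeroN T F μ ζ n X) := by
  simp [muZeroN, zetaIter, Fpow]

/-- `μ^(0,n)_X` is a T-algebra structure on `F^n T X`, and hence
`F (μ^(0,n)_X) = μ^(1,n)_X` is a split coequalizer of `F μ_{F^n T X}` and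
`F T (μ^(0,n)_X)` (with the canonical splittings `F η`); in particular the graded
monad `M_ζ` is depth-1. -/
theorem muZeroN_algebra_and_depth_one
    (T : C ⥤ C) (F : C ⥤ C)
    (η : ∀ X : C, X ⟶ T.obj X) (μ : ∀ X : C, T.obj (T.obj X) ⟶ T.obj X)
    (hη_nat : ∀ {X Y : C} (f : X ⟶ Y), f ≫ η Y = η X ≫ T.map f)
    (hμ_nat : ∀ {X Y : C} (f : X ⟶ Y), T.map (T.map f) ≫ μ Y = μ X ≫ T.map f)
    (h_unit_l : ∀ X : C, η (T.obj X) ≫ μ X = 𝟙 (T.obj X))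
    (h_unit_r : ∀ X : C, T.map (η X) ≫ μ X = 𝟙 (T.obj X))
    (h_assoc : ∀ X : C, T.map (μ X) ≫ μ X = μ (T.obj X) ≫ μ X)
    (ζ : ∀ X : C, T.obj (F.obj X) ⟶ F.obj (T.obj X))
    (hζ_nat : ∀ {X Y : C} (f : X ⟶ Y), T.map (F.map f) ≫ ζ Y = ζ X ≫ F.map (T.map f))
    (hζ_η : ∀ X : C, η (F.obj X) ≫ ζ X = F.map (η X))
    (hζ_μ : ∀ X : C, μ (F.obj X) ≫ ζ X = T.map (ζ X) ≫ ζ (T.obj X) ≫ F.map (μ X))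
    (n : ℕ) (X : C) :
    (η ((Fpow F n).obj (T.obj X)) ≫ muZeroN T F μ ζ n X = 𝟙 ((Fpow F n).obj (T.obj X))) ∧
    (μ ((Fpow F n).obj (T.obj X)) ≫ muZeroN T F μ ζ n X =
      T.map (muZeroN T F μ ζ n X) ≫ muZeroN T F μ ζ n X) ∧
    (F.map (μ ((Fpow F n).obj (T.obj X))) ≫ F.map (muZeroN T F μ ζ n X) =
      F.map (T.map (muZeroN T F μ ζ n X)) ≫ F.map (muZeroN T F μ ζ n X)) ∧
    (F.map (η ((Fpow F n).obj (T.obj X))) ≫ F.map (muZeroN T F μ ζ n X) =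
      𝟙 (F.obj ((Fpow F n).obj (T.obj X)))) ∧
    (F.map (η (T.obj ((Fpow F n).obj (T.obj X)))) ≫ F.map (μ ((Fpow F n).obj (T.obj X))) =
      𝟙 (F.obj (T.obj ((Fpow F n).obj (T.obj X))))) ∧
    (F.map (η (T.obj ((Fpow F n).obj (T.obj X)))) ≫ F.map (T.map (muZeroN T F μ ζ n X)) =
      F.map (muZeroN T F μ ζ n X) ≫ F.map (η ((Fpow F n).obj (T.obj X)))) ∧
    (∀ w : F.map (μ ((Fpow F n).obj (T.obj X))) ≫ F.map (muZeroN T F μ ζ n X) =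
        F.map (T.map (muZeroN T F μ ζ n X)) ≫ F.map (muZeroN T F μ ζ n X),
      Nonempty (Limits.IsColimit (Limits.Cofork.ofπ (F.map (muZeroN T F μ ζ n X)) w))) := by
  have assoc : μ ((Fpow F n).obj (T.obj X)) ≫ muZeroN T F μ ζ n X =
      T.map (muZeroN T F μ ζ n X) ≫ muZeroN T F μ ζ n X := by
    induction n with
    | zero => rw [muZeroN_zero]; exact (h_assoc X).symm
    | succ n ih =>
      rw [muZeroN_succ]
      exact lift_algebra_assoc hζ_nat hζ_μ ih
  have unit : η ((Fpow F n).obj (T.obj X)) ≫ muZeroN T F μ ζ n X = 𝟙 _ := by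
    clear assoc
    induction n with
    | zero => rw [muZeroN_zero]; exact h_unit_l X
    | succ n ih => rw [muZeroN_succ]; exact lift_algebra_unit hζ_η ih
  let split : IsSplitCoequalizer (T.map (muZeroN T F μ ζ n X))
      (μ ((Fpow F n).obj (T.obj X))) (muZeroN T F μ ζ n X) :=
    { rightSection := η _
      leftSection := η _
      condition := assoc.symm
      rightSection_π := unit
      leftSection_bottom := h_unit_l _
      leftSection_top := (hη_nat _).symm }
  let splitF := split.map F
  refine ⟨unit, assoc, splitF.condition.symm, splitF.rightSection_π, splitF.leftSection_bottom,
    splitF.leftSection_top, fun w => ⟨Limits.Cofork.IsColimit.mk' _ fun s =>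
      ⟨splitF.rightSection ≫ s.π, ?_, fun {m} hm => ?_⟩⟩⟩
  · change F.map (muZeroN T F μ ζ n X) ≫ splitF.rightSection ≫ s.π = s.π
    rw [← splitF.leftSection_top_assoc, ← s.condition, splitF.leftSection_bottom_assoc]
  · rw [← hm]
    exact (splitF.rightSection_π_assoc m).symm
end

section
/- Let T be a (lawful) monad on the category of types, Σ a type, and (A, a) a T-algebra, i.e. a : T A → A satisfies a (pure x) = x and a (join t) = a (map a t). Define the functor F X = A × (Σ → X) (acting on functions g by F g = Prod.map id (fun f => g ∘ f)) and the family of maps ζ_X : T (A × (Σ → X)) → A × (Σ → T X) by ζ_X t = (a (map Prod.fst t), fun σ => map (fun p => p.2 σ) t). Then ζ is a natural transformation and an Eilenberg–Moore law of T over F: for all X, (i) ζ_X ∘ pure = F(pure), i.e. ζ_X (pure (v, f)) = (v, fun σ => pure (f σ)); and (ii) ζ_X ∘ join = F(join) ∘ ζ_{T X} ∘ map ζ_X, i.e. for every t : T (T (A × (Σ → X))), ζ_X (join t) = (Prod.map id (fun g σ => join (g σ))) (ζ_{T X} (map ζ_X t)). -/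
universe u

/-- The Eilenberg–Moore law `ζ_X : T (A × (Σ → X)) → A × (Σ → T X)` for the machine
functor `F X = A × (Σ → X)`, induced by a T-algebra `a : T A → A`:
`ζ_X t = (a (Prod.fst <$> t), fun σ => (fun p => p.2 σ) <$> t)`. -/
def machineZeta {T : Type u → Type u} [Monad T] {A : Type u} (a : T A → A)
    (Alph : Type u) (X : Type u) (t : T (A × (Alph → X))) : A × (Alph → T X) :=
  (a (Prod.fst <$> t), fun s => (fun p : A × (Alph → X) => p.2 s) <$> t)

/-- for a lawful monad T and a T-algebra (A, a), the family
`machineZeta` is a natural transformation and an Eilenberg–Moore law of T over the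
machine functor `F X = A × (Σ → X)` (unit and multiplication laws). -/
theorem machineZeta_is_EM_law {T : Type u → Type u} [Monad T] [LawfulMonad T]
    {A : Type u} (a : T A → A)
    (ha_pure : ∀ x : A, a (pure x) = x)
    (ha_join : ∀ t : T (T A), a (joinM t) = a (a <$> t))
    (Alph : Type u) :
    (∀ (X Y : Type u) (g : X → Y) (t : T (A × (Alph → X))),
      machineZeta a Alph Y ((Prod.map id (fun f => g ∘ f)) <$> t) =
        Prod.map id (fun f s => g <$> f s) (machineZeta a Alph X t)) ∧
    (∀ (X : Type u) (v : A) (f : Alph → X),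
      machineZeta a Alph X (pure (v, f)) = (v, fun s => pure (f s))) ∧
    (∀ (X : Type u) (t : T (T (A × (Alph → X)))),
      machineZeta a Alph X (joinM t) =
        Prod.map id (fun g s => joinM (g s))
          (machineZeta a Alph (T X) (machineZeta a Alph X <$> t))) := by
  refine ⟨fun X Y g t => ?_, fun X v f => ?_, fun X t => ?_⟩
  · simp only [machineZeta, Functor.map_map, Prod.map_apply, id_eq, Prod.map_fst, Prod.map_snd,
      Function.comp_apply]
  · simp only [machineZeta, map_pure, ha_pure]
  · simp only [machineZeta, ← joinM_map_map, ha_join, Functor.map_map, Prod.map_apply, id_eq]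
end

section
/- Let X be a type and let Λ : PMF (Option X) → Option (PMF X) be the function characterized by: if p(none) ≠ 0 then Λ p = none, and if p(none) = 0 then Λ p = some q, where q is the unique probability mass function on X with q x = p (some x) for all x (such q exists since p(none) = 0). Then Λ satisfies the Eilenberg–Moore law equations of the PMF monad over the Option functor: (i) naturality: for every function g : X → Y and p : PMF (Option X), Λ (p.map (Option.map g)) = Option.map (PMF.map g) (Λ p); (ii) unit law: for every u : Option X, Λ (PMF.pure u) = Option.map PMF.pure u; (iii) multiplication law: for every P : PMF (PMF (Option X)), Λ (P.bind id) = Option.map (fun Q : PMF (PMF X) => Q.bind id) (Λ' (P.map Λ)), where Λ' denotes the same construction at type PMF X. -/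
universe u

open scoped ENNReal

/-- The black-hole law `Λ : PMF (Option X) → Option (PMF X)`: if `p` puts nonzero mass
on `none` then `Λ p = none`; otherwise `Λ p = some q` where `q x = p (some x)`. -/
noncomputable def blackHole {X : Type u} (p : PMF (Option X)) : Option (PMF X) :=
  if h : p none = 0 then
    some ⟨fun x => p (some x),
      ((Option.some_injective X).hasSum_iff (fun o ho => by
        cases o with
        | none => exact h
        | some x => exact absurd ⟨x, rfl⟩ ho)).2 p.2⟩
  else none

theorem blackHole_eq_none_iff {X : Type u} {p : PMF (Option X)} :
    blackHole p = none ↔ none ∈ p.support := by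
  simp [blackHole, PMF.mem_support_iff]

theorem PMF.map_apply_of_injective {X Y : Type*} {f : X → Y} (hf : Function.Injective f)
    (q : PMF X) (x : X) : q.map f (f x) = q x := by
  classical
  rw [PMF.map_apply, tsum_eq_single x]
  · simp
  · intro y hy
    rw [if_neg fun h => hy (hf h).symm]

theorem blackHole_map_some {X : Type u} (q : PMF X) : blackHole (q.map some) = some q := by
  have h : q.map some none = 0 := by simp [PMF.map_apply]
  rw [blackHole, dif_pos h]
  exact congrArg some (PMF.ext fun x => PMF.map_apply_of_injective (Option.some_injective X) q x)

theorem eq_map_some_of_blackHole_eq_some {X : Type u} {p : PMF (Option X)} {q : PMF X}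
    (hq : blackHole p = some q) : p = q.map some := by
  unfold blackHole at hq
  split_ifs at hq with h
  have hval : ∀ x, p (some x) = q x := fun x => by
    rw [← Option.some.inj hq]
    rfl
  ext o
  cases o with
  | none => simp [PMF.map_apply, h]
  | some x => rw [hval, PMF.map_apply_of_injective (Option.some_injective X)]

theorem PMF.bind_congr_of_mem_support {X Y : Type*} (p : PMF X) {f g : X → PMF Y}
    (h : ∀ x ∈ p.support, f x = g x) : p.bind f = p.bind g := by
  ext y
  simp only [PMF.bind_apply]
  refine tsum_congr fun x => ?_
  by_cases hx : p x = 0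
  · simp [hx]
  · rw [h x ((p.mem_support_iff x).2 hx)]

theorem blackHole_map {X Y : Type u} (g : X → Y) (p : PMF (Option X)) :
    blackHole (p.map (Option.map g)) = Option.map (PMF.map g) (blackHole p) := by
  cases hp : blackHole p with
  | none =>
    rw [Option.map_none, blackHole_eq_none_iff, PMF.mem_support_map_iff]
    exact ⟨none, blackHole_eq_none_iff.1 hp, rfl⟩
  | some q =>
    rw [eq_map_some_of_blackHole_eq_some hp, PMF.map_comp, Option.map_some,
      ← blackHole_map_some (q.map g), PMF.map_comp]
    rfl

theorem blackHole_pure {X : Type u} (u : Option X) :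
    blackHole (PMF.pure u) = Option.map PMF.pure u := by
  cases u with
  | none => simp [blackHole_eq_none_iff]
  | some x => rw [← PMF.pure_map some x, blackHole_map_some, Option.map_some]

theorem blackHole_bind_id {X : Type u} (P : PMF (PMF (Option X))) :
    blackHole (P.bind id) =
      Option.map (fun Q : PMF (PMF X) => Q.bind id) (blackHole (P.map blackHole)) := by
  cases hP : blackHole (P.map blackHole) with
  | none =>
    obtain ⟨p, hp, hpn⟩ := (PMF.mem_support_map_iff _ _ _).1 (blackHole_eq_none_iff.1 hP)
    rw [Option.map_none, blackHole_eq_none_iff, PMF.mem_support_bind_iff]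
    exact ⟨p, hp, blackHole_eq_none_iff.1 hpn⟩
  | some Q =>
    have hQ := eq_map_some_of_blackHole_eq_some hP
    -- `e` inverts `blackHole` on the support of `P`, where `blackHole` never fails.
    let e : Option (PMF X) → PMF (Option X) := fun o => o.elim (PMF.pure none) (PMF.map some)
    have he : ∀ p, e (blackHole p) = p ∨ blackHole p = none := fun p => by
      cases hp : blackHole p with
      | none => exact Or.inr rfl
      | some q => exact Or.inl (eq_map_some_of_blackHole_eq_some hp).symm
    have hsupp : ∀ p ∈ P.support, id p = (e ∘ blackHole) p := fun p hp => by
      refine ((he p).resolve_right fun hpn => ?_).symm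
      have : none ∈ (P.map blackHole).support := (PMF.mem_support_map_iff _ _ _).2 ⟨p, hp, hpn⟩
      rw [← blackHole_eq_none_iff, hP] at this
      cases this
    have hbind : P.bind id = (Q.bind id).map some := by
      rw [P.bind_congr_of_mem_support hsupp, ← PMF.bind_map, hQ, PMF.bind_map, PMF.map_bind]
      rfl
    rw [hbind, blackHole_map_some, Option.map_some]

/-- the black-hole map `Λ` satisfies the Eilenberg–Moore law equations of
the PMF monad over the Option functor: naturality, the unit law, and the
multiplication law. -/
theorem blackHole_is_EM_law :
    (∀ {X Y : Type u} (g : X → Y) (p : PMF (Option X)),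
      blackHole (p.map (Option.map g)) = Option.map (PMF.map g) (blackHole p)) ∧
    (∀ {X : Type u} (u : Option X),
      blackHole (PMF.pure u) = Option.map PMF.pure u) ∧
    (∀ {X : Type u} (P : PMF (PMF (Option X))),
      blackHole (P.bind id) =
        Option.map (fun Q : PMF (PMF X) => Q.bind id) (blackHole (P.map blackHole))) := by
  exact ⟨blackHole_map, blackHole_pure, blackHole_bind_id⟩
end

section
/- Let I = {r : ℝ // 0 ≤ r ∧ r ≤ 1} be the unit interval and define the expected-value map E : PMF I → ℝ by E p = ∑' v, (v : ℝ) * (p v).toReal. Then: (i) 0 ≤ E p ≤ 1 for every p : PMF I, so E corestricts to a map E' : PMF I → I; (ii) E (PMF.pure v) = v for every v ∈ I; and (iii) for every P : PMF (PMF I), E (P.bind id) = E (P.map E'). In other words, taking expected values defines an Eilenberg–Moore algebra structure for the PMF monad on the unit interval. -/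
open scoped ENNReal

/-- The unit interval `I = {r : ℝ // 0 ≤ r ∧ r ≤ 1}`. -/
def UI : Type := {r : ℝ // 0 ≤ r ∧ r ≤ 1}

/-- The expected value of a probability mass function on the unit interval:
`E p = ∑' v, v * (p v).toReal`. -/
noncomputable def expVal (p : PMF UI) : ℝ :=
  ∑' v : UI, (v.1 : ℝ) * (p v).toReal

/-- The expected value of a probability mass function on the unit interval, computed in `ℝ≥0∞`. -/
noncomputable def eexpVal (p : PMF UI) : ℝ≥0∞ :=
  ∑' v : UI, ENNReal.ofReal v.1 * p v

theorem eexpVal_le_one (p : PMF UI) : eexpVal p ≤ 1 := by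
  rw [← p.tsum_coe]
  exact ENNReal.tsum_le_tsum fun v => mul_le_of_le_one_left' (ENNReal.ofReal_le_one.2 v.2.2)

theorem toReal_eexpVal (p : PMF UI) : (eexpVal p).toReal = expVal p := by
  rw [eexpVal, ENNReal.tsum_toReal_eq fun v =>
    ENNReal.mul_ne_top ENNReal.ofReal_ne_top (p.apply_ne_top v)]
  exact tsum_congr fun v => by rw [ENNReal.toReal_mul, ENNReal.toReal_ofReal v.2.1]

theorem ofReal_expVal (p : PMF UI) : ENNReal.ofReal (expVal p) = eexpVal p := by
  rw [← toReal_eexpVal,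
    ENNReal.ofReal_toReal ((eexpVal_le_one p).trans_lt ENNReal.one_lt_top).ne]

theorem eexpVal_pure (v : UI) : eexpVal (PMF.pure v) = ENNReal.ofReal v.1 := by
  rw [eexpVal, tsum_eq_single v fun w hw => by rw [PMF.pure_apply_of_ne _ _ hw, mul_zero],
    PMF.pure_apply_self, mul_one]

theorem eexpVal_bind {α : Type*} (P : PMF α) (f : α → PMF UI) :
    eexpVal (P.bind f) = ∑' a, P a * eexpVal (f a) := by
  simp only [eexpVal, PMF.bind_apply, ← ENNReal.tsum_mul_left]
  rw [ENNReal.tsum_comm]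
  exact tsum_congr fun a => tsum_congr fun v => mul_left_comm _ _ _

theorem eexpVal_map {α : Type*} (P : PMF α) (f : α → UI) :
    eexpVal (P.map f) = ∑' a, P a * ENNReal.ofReal (f a).1 := by
  simp only [PMF.map, eexpVal_bind, Function.comp_apply, eexpVal_pure]

/-- taking expected values defines an Eilenberg–Moore algebra structure
for the PMF monad on the unit interval: (i) `0 ≤ E p ≤ 1`, so `E` corestricts to
`E' : PMF I → I`; (ii) `E (pure v) = v`; (iii) `E (P.bind id) = E (P.map E')`. -/
theorem expVal_is_EM_algebra :
    (∀ p : PMF UI, 0 ≤ expVal p ∧ expVal p ≤ 1) ∧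
    (∀ v : UI, expVal (PMF.pure v) = v.1) ∧
    (∀ E' : PMF UI → UI, (∀ p : PMF UI, (E' p).1 = expVal p) →
      ∀ P : PMF (PMF UI), expVal (P.bind id) = expVal (P.map E')) := by
  refine ⟨fun p => ?_, fun v => ?_, fun E' hE' P => ?_⟩
  · rw [← toReal_eexpVal]
    exact ⟨ENNReal.toReal_nonneg, ENNReal.toReal_le_of_le_ofReal zero_le_one
      (by simpa using eexpVal_le_one p)⟩
  · rw [← toReal_eexpVal, eexpVal_pure, ENNReal.toReal_ofReal v.2.1]
  · rw [← toReal_eexpVal, ← toReal_eexpVal, eexpVal_bind, eexpVal_map]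
    simp only [hE', ofReal_expVal, id_eq]
end
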